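/- Let T be a G-tree, S a finite subset of G, z ∈ T \ T_S, and x = p_{T_S}(z) the nearest point projection of z to T_S. Then there exists g ∈ S with d(x,gx) = l_T(S) such that x lies on the arc from z to T_g. -/

import Mathlib

open Set Topology

noncomputable section

/-- The segment between two points of a metric space. -/
def seg {X : Type} [MetricSpace X] (x y : X) : Set X :=
  {z | dist x z + dist z y = dist x y}

/-- A nonempty geodesic 0-hyperbolic metric space: a metric tree. -/
def IsTreeSpace (X : Type) [MetricSpace X] : Prop :=
  Nonempty X ∧
    (∀ x y : X, ∀ r : ℝ, 0 ≤ r → r ≤ dist x y →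
      ∃ z : X, dist x z = r ∧ dist z y = dist x y - r) ∧
    ∀ x y z w : X, dist x y + dist z w ≤ max (dist x z + dist y w) (dist x w + dist y z)

/-- A finite metric simplicial tree: a metric tree which is a finite union of segments. -/
def IsFiniteSimpTree (X : Type) [MetricSpace X] : Prop :=
  IsTreeSpace X ∧ ∃ V : Set X, V.Finite ∧ V.Nonempty ∧
    ∀ x : X, ∃ u ∈ V, ∃ v ∈ V, x ∈ seg u v

/-- A subtree: a nonempty subset closed under taking segments. -/
def IsSubtreeSet {X : Type} [MetricSpace X] (A : Set X) : Prop :=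
  A.Nonempty ∧ ∀ x ∈ A, ∀ y ∈ A, seg x y ⊆ A

/-- An `ε`-approximation between `K ⊆ X` and `L ⊆ Y`: a relation that surjects onto
each factor and distorts distances by less than `ε`. -/
def IsApprox {X Y : Type} [MetricSpace X] [MetricSpace Y]
    (K : Set X) (L : Set Y) (R : Set (X × Y)) (ε : ℝ) : Prop :=
  R ⊆ K ×ˢ L ∧ (∀ x ∈ K, ∃ y : Y, (x, y) ∈ R) ∧ (∀ y ∈ L, ∃ x : X, (x, y) ∈ R) ∧
    ∀ ⦃x : X⦄ ⦃y : Y⦄, (x, y) ∈ R → ∀ ⦃x' : X⦄ ⦃y' : Y⦄, (x', y') ∈ R →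
      |dist x x' - dist y y'| < ε

/-- A full approximation: related pairs relate the whole segments between them. -/
def IsFull {X Y : Type} [MetricSpace X] [MetricSpace Y] (R : Set (X × Y)) : Prop :=
  ∀ ⦃x : X⦄ ⦃y : Y⦄, (x, y) ∈ R → ∀ ⦃x' : X⦄ ⦃y' : Y⦄, (x', y') ∈ R →
    (∀ z ∈ seg x x', ∃ w ∈ seg y y', (z, w) ∈ R) ∧
    (∀ w ∈ seg y y', ∃ z ∈ seg x x', (z, w) ∈ R)

/-- A morphism of metric trees: every nondegenerate segment has a nondegenerate
initial subsegment on which the map is an isometry. -/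
def IsMorphism {X X' : Type} [MetricSpace X] [MetricSpace X'] (φ : X → X') : Prop :=
  ∀ x y : X, x ≠ y → ∃ x' : X, x' ∈ seg x y ∧ x' ≠ x ∧
    ∀ u ∈ seg x x', ∀ v ∈ seg x x', dist (φ u) (φ v) = dist u v

/-- `m(φ) = sup { d(φ(z),φ(x)) | z ∈ [x,x'], φ(x) = φ(x') }`. -/
def mFold {X X' : Type} [MetricSpace X] [MetricSpace X'] (φ : X → X') : ℝ :=
  sSup {r : ℝ | ∃ x x' z : X, φ x = φ x' ∧ z ∈ seg x x' ∧ r = dist (φ z) (φ x)}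

/-- The graph of a map. -/
def gr {X X' : Type} (φ : X → X') : Set (X × X') := {p | p.2 = φ p.1}

/-- `V_t = {(x,y) : d(φ(x),y) ≤ m(φ)t}`. -/
def Vset {X X' : Type} [MetricSpace X] [MetricSpace X'] (φ : X → X') (t : ℝ) :
    Set (X × X') := {p | dist (φ p.1) p.2 ≤ mFold φ * t}

/-- `W_t`: points of `V_t` whose horizontal path component meets the graph of `φ`. -/
def Wset {X X' : Type} [MetricSpace X] [MetricSpace X'] (φ : X → X') (t : ℝ) :
    Set (X × X') :=
  {p | p ∈ Vset φ t ∧ ∃ q ∈ gr φ, JoinedIn (Vset φ t ∩ {r | r.2 = p.2}) p q}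

/-- Two points of `W_t` lie in the same member of the partition `𝔉_t` (same horizontal
path component of `W_t`). -/
def SameFiber {X X' : Type} [MetricSpace X] [MetricSpace X'] (φ : X → X') (t : ℝ)
    (p q : X × X') : Prop :=
  p.2 = q.2 ∧ JoinedIn (Wset φ t ∩ {r | r.2 = p.2}) p q

/-- An `ε`-approximation `(R,R')` (assumed full) between the maps `φ` and `ψ`. -/
def MapApprox {X X' Y Y' : Type} [MetricSpace X] [MetricSpace X'] [MetricSpace Y]
    [MetricSpace Y'] (φ : X → X') (ψ : Y → Y')
    (R : Set (X × Y)) (R' : Set (X' × Y')) (ε : ℝ) : Prop :=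
  IsApprox univ univ R ε ∧ IsApprox univ univ R' ε ∧ IsFull R ∧ IsFull R' ∧
    ∀ x y, (x, y) ∈ R → (φ x, ψ y) ∈ R'

/-- Distance with respect to an explicitly given metric space structure. -/
def distIn {Q : Type} (m : MetricSpace Q) (a b : Q) : ℝ :=
  @dist Q m.toPseudoMetricSpace.toDist a b

/-- `p` is a nearest point of `A` to `x`. -/
def IsNearestPt {X : Type} [MetricSpace X] (A : Set X) (x p : X) : Prop :=
  p ∈ A ∧ ∀ q ∈ A, dist x p ≤ dist x q

/-- `m` is a midpoint (circumcenter) of the set `A`. -/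
def IsMidpointOf {X : Type} [MetricSpace X] (A : Set X) (m : X) : Prop :=
  m ∈ A ∧ ∀ m' ∈ A, sSup (dist m '' A) ≤ sSup (dist m' '' A)

/-- Combinatorial data for a taut corner path in `W_t(φ)`: a concatenation of pieces,
each essential (in the graph) or nonessential (in a horizontal component). -/
structure CornerPath {X X' : Type} [MetricSpace X] [MetricSpace X']
    (φ : X → X') (t : ℝ) where
  n : ℕ
  pts : Fin (n + 1) → X × X'
  ess : Fin n → Bool

namespace CornerPath

variable {X X' : Type} [MetricSpace X] [MetricSpace X'] {φ : X → X'} {t : ℝ}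

/-- `γ` is a taut corner path in `W_t(φ)` from `z` to `w`: the pieces lie in `W_t`,
essential pieces are non-backtracking paths in the graph, nonessential pieces lie in a
single member of `𝔉_t`, consecutive pieces have different types and distinct
nonessential pieces lie in distinct members of `𝔉_t`. -/
def IsTaut (γ : CornerPath φ t) (z w : X × X') : Prop :=
  γ.pts 0 = z ∧ γ.pts (Fin.last γ.n) = w ∧
  (∀ i : Fin (γ.n + 1), γ.pts i ∈ Wset φ t) ∧
  (∀ i : Fin γ.n, γ.ess i = true → γ.pts i.castSucc ∈ gr φ ∧ γ.pts i.succ ∈ gr φ) ∧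
  (∀ i : Fin γ.n, γ.ess i = false → SameFiber φ t (γ.pts i.castSucc) (γ.pts i.succ)) ∧
  (∀ i : Fin γ.n, ∀ h : i.1 + 1 < γ.n, γ.ess i ≠ γ.ess ⟨i.1 + 1, h⟩) ∧
  ∀ i j : Fin γ.n, i ≠ j → γ.ess i = false → γ.ess j = false →
    ¬ SameFiber φ t (γ.pts i.castSucc) (γ.pts j.castSucc)

/-- The length of a corner path: the total length of its essential pieces. -/
def length (γ : CornerPath φ t) : ℝ :=
  ∑ i : Fin γ.n, if γ.ess i = true then dist (γ.pts i.castSucc).1 (γ.pts i.succ).1 else 0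

end CornerPath

/-- The family of folded trees `X_t = W_t(φ)/𝔉_t` associated to a morphism `φ`,
with the quotient maps `[·]_t` and the metric determined by lengths of taut corner
paths. -/
structure FoldFamily {X X' : Type} [MetricSpace X] [MetricSpace X'] (φ : X → X') where
  Q : ℝ → Type
  metricQ : ∀ t : ℝ, MetricSpace (Q t)
  cls : ∀ t : ℝ, X × X' → Q t
  surj : ∀ t : ℝ, 0 ≤ t → t ≤ 1 → ∀ q : Q t, ∃ p ∈ Wset φ t, cls t p = q
  eq_iff : ∀ t : ℝ, 0 ≤ t → t ≤ 1 → ∀ p ∈ Wset φ t, ∀ p' ∈ Wset φ t,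
    (cls t p = cls t p' ↔ SameFiber φ t p p')
  dist_eq : ∀ t : ℝ, 0 ≤ t → t ≤ 1 → ∀ p ∈ Wset φ t, ∀ p' ∈ Wset φ t,
    ∀ γ : CornerPath φ t, γ.IsTaut p p' →
      distIn (metricQ t) (cls t p) (cls t p') = γ.length

/-- A `G`-tree: a metric simplicial tree (nonempty, geodesic, 0-hyperbolic, with a
`G`-invariant locally finite covering family of vertices) on which `G` acts by
isometries. -/
structure GTree (G : Type) [Group G] where
  carrier : Type
  [metric : MetricSpace carrier]
  [action : MulAction G carrier]
  nonempty : Nonempty carrier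
  isom : ∀ g : G, Isometry (fun x : carrier => g • x)
  geodesic : ∀ x y : carrier, ∀ r : ℝ, 0 ≤ r → r ≤ dist x y →
    ∃ z : carrier, dist x z = r ∧ dist z y = dist x y - r
  fourPoint : ∀ x y z w : carrier,
    dist x y + dist z w ≤ max (dist x z + dist y w) (dist x w + dist y z)
  vertices : Set carrier
  vertexInv : ∀ g : G, ∀ x ∈ vertices, g • x ∈ vertices
  vertexCover : ∀ x : carrier, ∃ u ∈ vertices, ∃ v ∈ vertices, x ∈ seg u v
  segLocFin : ∀ x y : carrier, (seg x y ∩ vertices).Finite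

attribute [instance] GTree.metric GTree.action

namespace GTree

variable {G : Type} [Group G] (T : GTree G)

/-- The translation length of `g`. -/
def ell (g : G) : ℝ := ⨅ x : T.carrier, dist x (g • x)

/-- The characteristic set of `g`. -/
def charSet (g : G) : Set T.carrier := {x | dist x (g • x) = T.ell g}

def IsHyperbolic (g : G) : Prop := 0 < T.ell g

/-- Irreducibility: there are two hyperbolic elements whose axes have bounded
intersection. -/
def Irreducible : Prop :=
  ∃ g h : G, T.IsHyperbolic g ∧ T.IsHyperbolic h ∧
    Bornology.IsBounded (T.charSet g ∩ T.charSet h)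

/-- A subgroup is elliptic if it has a global fixed point. -/
def EllipticSubgroup (H : Subgroup G) : Prop := ∃ x : T.carrier, ∀ h ∈ H, h • x = x

def IsSubtree (A : Set T.carrier) : Prop :=
  A.Nonempty ∧ ∀ x ∈ A, ∀ y ∈ A, seg x y ⊆ A

/-- Minimality: no proper invariant subtree. -/
def Minimal : Prop :=
  ∀ A : Set T.carrier, T.IsSubtree A → IsClosed A →
    (∀ g : G, ∀ x ∈ A, g • x ∈ A) → A = Set.univ

/-- Cocompactness of the action. -/
def Cocompact : Prop :=
  ∃ K : Set T.carrier, IsCompact K ∧ ∀ x : T.carrier, ∃ g : G, g • x ∈ K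

/-- `u` and `v` span an edge. -/
def IsEdge (u v : T.carrier) : Prop :=
  u ∈ T.vertices ∧ v ∈ T.vertices ∧ u ≠ v ∧ seg u v ∩ T.vertices = {u, v}

/-- A reduced `G`-tree: whenever `G_e = G_u` for an edge `e = [u,v]`, the endpoints
are in the same orbit. -/
def Reduced : Prop :=
  ∀ u v : T.carrier, T.IsEdge u v →
    MulAction.stabilizer G u ≤ MulAction.stabilizer G v → ∃ g : G, g • u = v

/-- The fixed-point set of a subgroup. -/
def fixedSet (H : Subgroup G) : Set T.carrier := {x | ∀ h ∈ H, h • x = x}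

/-- The characteristic set of a subgroup, taken to be a given basepoint when the
subgroup is trivial. -/
def charOf (H : Subgroup G) (y₀ : T.carrier) : Set T.carrier :=
  {y | (H = ⊥ ∧ y = y₀) ∨ (H ≠ ⊥ ∧ ∀ h ∈ H, h • y = y)}

/-- `max_{g ∈ S} d(x, gx)`. -/
def dispS (S : Finset G) (x : T.carrier) : ℝ := sSup {d : ℝ | ∃ g ∈ S, d = dist x (g • x)}

/-- `l_T(S) = min_x max_{g ∈ S} d(x,gx)`. -/
def ellS (S : Finset G) : ℝ := sInf {d : ℝ | ∃ x : T.carrier, d = T.dispS S x}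

/-- `T_S`, the characteristic set of `S`. -/
def charSetS (S : Finset G) : Set T.carrier := {x | T.dispS S x = T.ellS S}

/-- `Z_S = ⋂_{g ∈ S'} T_g` where `S' = {g ∈ S : l_T(g) = l_T(S)}`. -/
def ZS (S : Finset G) : Set T.carrier :=
  ⋂ g ∈ {g ∈ (S : Set G) | T.ell g = T.ellS S}, T.charSet g

end GTree

/-- Two `G`-trees have the same elliptic subgroups. -/
def SameElliptics {G : Type} [Group G] (T T' : GTree G) : Prop :=
  ∀ H : Subgroup G, T.EllipticSubgroup H ↔ T'.EllipticSubgroup H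

/-- An unnormalized deformation space: a maximal set of minimal cocompact `G`-trees
with the same elliptic subgroups. -/
def IsUnnormDefSpace {G : Type} [Group G] (𝒯 : Set (GTree G)) : Prop :=
  𝒯.Nonempty ∧ (∀ T ∈ 𝒯, T.Minimal ∧ T.Cocompact) ∧
    (∀ T ∈ 𝒯, ∀ T' ∈ 𝒯, SameElliptics T T') ∧
    ∀ T ∈ 𝒯, ∀ T' : GTree G, T'.Minimal → T'.Cocompact → SameElliptics T T' → T' ∈ 𝒯

/-- `P`-equivariance of a relation between subsets of two `G`-trees. -/
def PEquivariant {G : Type} [Group G] (T Y : GTree G) (K : Set T.carrier) (L : Set Y.carrier)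
    (R : Set (T.carrier × Y.carrier)) (P : Finset G) : Prop :=
  ∀ g ∈ P, ∀ x y, (x, y) ∈ R → x ∈ K → g • x ∈ K → y ∈ L →
    g • y ∈ L ∧ (g • x, g • y) ∈ R

/-- An equivariant morphism of `G`-trees. -/
def IsGMorphism {G : Type} [Group G] (T T' : GTree G) (φ : T.carrier → T'.carrier) : Prop :=
  (∀ (g : G) (x : T.carrier), φ (g • x) = g • φ x) ∧ IsMorphism φ

/-- A basic open set for the Hausdorff–Gromov topology. -/
def basicOpen {G : Type} [Group G] (𝒯 : Set (GTree G)) (X : GTree G)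
    (K : Set X.carrier) (P : Finset G) (ε : ℝ) : Set {T : GTree G // T ∈ 𝒯} :=
  {Y | ∃ L : Set Y.1.carrier, IsCompact L ∧ ∃ R : Set (X.carrier × Y.1.carrier),
    IsClosed R ∧ IsApprox K L R ε ∧ PEquivariant X Y.1 K L R P}

/-- The Hausdorff–Gromov topology on a set of `G`-trees. -/
def HGtop {G : Type} [Group G] (𝒯 : Set (GTree G)) :
    TopologicalSpace {T : GTree G // T ∈ 𝒯} :=
  TopologicalSpace.generateFrom
    {U | ∃ X : GTree G, X ∈ 𝒯 ∧ ∃ K : Set X.carrier, IsCompact K ∧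
      ∃ P : Finset G, ∃ ε : ℝ, 0 < ε ∧ U = basicOpen 𝒯 X K P ε}

/-- The equivariant folding construction for a morphism of `G`-trees: the `G`-trees
`T_t = W_t/𝔉_t`, the class maps `[·]_t` and the induced morphisms `φ_{st}`. -/
structure GFoldData {G : Type} [Group G] (T T' : GTree G)
    (φ : T.carrier → T'.carrier) where
  tree : ℝ → GTree G
  cls : ∀ t : ℝ, T.carrier × T'.carrier → (tree t).carrier
  map : ∀ s t : ℝ, (tree s).carrier → (tree t).carrier
  surj : ∀ t : ℝ, 0 ≤ t → t ≤ 1 → ∀ q : (tree t).carrier, ∃ p ∈ Wset φ t, cls t p = q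
  eq_iff : ∀ t : ℝ, 0 ≤ t → t ≤ 1 → ∀ p ∈ Wset φ t, ∀ p' ∈ Wset φ t,
    (cls t p = cls t p' ↔ SameFiber φ t p p')
  dist_eq : ∀ t : ℝ, 0 ≤ t → t ≤ 1 → ∀ p ∈ Wset φ t, ∀ p' ∈ Wset φ t,
    ∀ γ : CornerPath φ t, γ.IsTaut p p' → dist (cls t p) (cls t p') = γ.length
  cls_equiv : ∀ t : ℝ, ∀ g : G, ∀ p : T.carrier × T'.carrier,
    cls t (g • p.1, g • p.2) = g • cls t p
  map_cls : ∀ s t : ℝ, 0 ≤ s → s ≤ t → t ≤ 1 → ∀ p ∈ Wset φ s,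
    map s t (cls s p) = cls t p
  mapMorph : ∀ s t : ℝ, 0 ≤ s → s ≤ t → t ≤ 1 →
    IsGMorphism (tree s) (tree t) (map s t)

/-- A morphism between two `G`-trees of `𝒯`. -/
structure MorphIn {G : Type} [Group G] (𝒯 : Set (GTree G)) where
  dom : GTree G
  cod : GTree G
  dom_mem : dom ∈ 𝒯
  cod_mem : cod ∈ 𝒯
  toFun : dom.carrier → cod.carrier
  morph : IsGMorphism dom cod toFun

/-- A basic open set for the Gromov–Hausdorff topology on maps. -/
def mapBasicOpen {G : Type} [Group G] {𝒯 : Set (GTree G)} (φ : MorphIn 𝒯)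
    (K : Set φ.dom.carrier) (K' : Set φ.cod.carrier) (P : Finset G) (ε : ℝ) :
    Set (MorphIn 𝒯) :=
  {ψ | ∃ L : Set ψ.dom.carrier, ∃ L' : Set ψ.cod.carrier,
    IsCompact L ∧ IsCompact L' ∧ ψ.toFun '' L ⊆ L' ∧
    ∃ R : Set (φ.dom.carrier × ψ.dom.carrier),
    ∃ R' : Set (φ.cod.carrier × ψ.cod.carrier),
      IsClosed R ∧ IsClosed R' ∧ IsApprox K L R ε ∧ IsApprox K' L' R' ε ∧
      PEquivariant φ.dom ψ.dom K L R P ∧ PEquivariant φ.cod ψ.cod K' L' R' P ∧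
      ∀ x y, (x, y) ∈ R → (φ.toFun x, ψ.toFun y) ∈ R'}

/-- The Gromov–Hausdorff topology on the space of morphisms `𝓜(𝒯)`. -/
def MorphTop {G : Type} [Group G] (𝒯 : Set (GTree G)) : TopologicalSpace (MorphIn 𝒯) :=
  TopologicalSpace.generateFrom
    {U | ∃ φ : MorphIn 𝒯, ∃ K : Set φ.dom.carrier, ∃ K' : Set φ.cod.carrier,
      IsCompact K ∧ IsCompact K' ∧ φ.toFun '' K ⊆ K' ∧
      ∃ P : Finset G, ∃ ε : ℝ, 0 < ε ∧ U = mapBasicOpen φ K K' P ε}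

/-- An equivariant map from `G` to a `G`-tree of `𝒯`. -/
structure EquivMapIn {G : Type} [Group G] (𝒯 : Set (GTree G)) where
  cod : GTree G
  cod_mem : cod ∈ 𝒯
  toFun : G → cod.carrier
  equivar : ∀ g h : G, toFun (g * h) = g • toFun h

/-- A basic open set for the topology on `ℰ(G,𝒯)`. -/
def eBasicOpen {G : Type} [Group G] {𝒯 : Set (GTree G)} (f : EquivMapIn 𝒯)
    (K : Set f.cod.carrier) (P : Finset G) (ε : ℝ) : Set (EquivMapIn 𝒯) :=
  {f' | ∃ L : Set f'.cod.carrier, IsCompact L ∧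
    ∃ R : Set (f.cod.carrier × f'.cod.carrier), IsClosed R ∧ IsApprox K L R ε ∧
      PEquivariant f.cod f'.cod K L R P ∧ ∀ g ∈ P, (f.toFun g, f'.toFun g) ∈ R}

/-- The topology on `ℰ(G,𝒯)`. -/
def ETop {G : Type} [Group G] (𝒯 : Set (GTree G)) : TopologicalSpace (EquivMapIn 𝒯) :=
  TopologicalSpace.generateFrom
    {U | ∃ f : EquivMapIn 𝒯, ∃ K : Set f.cod.carrier, IsCompact K ∧
      ∃ P : Finset G, (∀ g ∈ P, f.toFun g ∈ K) ∧
      ∃ ε : ℝ, 0 < ε ∧ U = eBasicOpen f K P ε}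

/-- A transverse map from the `G`-tree `T` to a `G`-tree of `𝒯`. -/
structure TransMapIn {G : Type} [Group G] (𝒯 : Set (GTree G)) (T : GTree G) where
  cod : GTree G
  cod_mem : cod ∈ 𝒯
  toFun : T.carrier → cod.carrier
  cont : Continuous toFun
  vert : ∀ v ∈ T.vertices, toFun v ∈ cod.vertices
  injEdge : ∀ u v : T.carrier, T.IsEdge u v → Set.InjOn toFun (seg u v)

/-- A basic open set for the topology on `𝒮(T,𝒯)`. -/
def sBasicOpen {G : Type} [Group G] {𝒯 : Set (GTree G)} {T : GTree G}
    (f : TransMapIn 𝒯 T) (K : Set T.carrier) (K' : Set f.cod.carrier)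
    (P : Finset G) (ε : ℝ) : Set (TransMapIn 𝒯 T) :=
  {f' | ∃ L : Set T.carrier, ∃ L' : Set f'.cod.carrier,
    IsCompact L ∧ IsCompact L' ∧ f'.toFun '' L ⊆ L' ∧
    ∃ R : Set (T.carrier × T.carrier), ∃ R' : Set (f.cod.carrier × f'.cod.carrier),
      IsClosed R ∧ IsClosed R' ∧ IsApprox K L R ε ∧ IsApprox K' L' R' ε ∧
      PEquivariant T T K L R P ∧ PEquivariant f.cod f'.cod K' L' R' P ∧
      ∀ x y, (x, y) ∈ R → (f.toFun x, f'.toFun y) ∈ R'}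

/-- The topology on `𝒮(T,𝒯)`. -/
def STop {G : Type} [Group G] (𝒯 : Set (GTree G)) (T : GTree G) :
    TopologicalSpace (TransMapIn 𝒯 T) :=
  TopologicalSpace.generateFrom
    {U | ∃ f : TransMapIn 𝒯 T, ∃ K : Set T.carrier, ∃ K' : Set f.cod.carrier,
      IsCompact K ∧ IsCompact K' ∧ f.toFun '' K ⊆ K' ∧
      ∃ P : Finset G, ∃ ε : ℝ, 0 < ε ∧ U = sBasicOpen f K K' P ε}

/-- `G`-equivariantly homeomorphic `G`-trees. -/
def EquivHomeo {G : Type} [Group G] (T T' : GTree G) : Prop :=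
  ∃ f : T.carrier ≃ T'.carrier, (∀ (g : G) (x : T.carrier), f (g • x) = g • f x) ∧
    Continuous f ∧ Continuous f.symm

/-- Two `G`-trees are homothetic: related by an equivariant homothety. -/
def Homothetic {G : Type} [Group G] (T T' : GTree G) : Prop :=
  ∃ (r : ℝ) (f : T.carrier ≃ T'.carrier), 0 < r ∧
    (∀ (g : G) (x : T.carrier), f (g • x) = g • f x) ∧
    ∀ x y : T.carrier, dist (f x) (f y) = r * dist x y

theorem aux_proj {G : Type} [Group G] (T : GTree G) (g : G) (z : T.carrier) :
    ∃ y : T.carrier, IsNearestPt (T.charSet g) z y := by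
  have key : ∃ y : T.carrier, dist z (g • z) = 2 * dist z y + dist y (g • y) ∧
      ∀ p : T.carrier, dist y (g • y) ≤ dist p (g • p) := by
    have hi : ∀ a b : T.carrier, dist (g • a) (g • b) = dist a b := fun a b => (T.isom g).dist_eq a b
    by_cases hc : dist z (g • z) ≤ 2 * (dist z (g • z) - dist z (g • g • z) / 2)
    · obtain ⟨m, h1, h2⟩ := T.geodesic z (g • z) (dist z (g • z) / 2) (by positivity)
        (by linarith [dist_nonneg (x := z) (y := g • z)])
      have e1 := T.fourPoint (g • m) z (g • z) (g • g • z)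
      have e2 := T.fourPoint m (g • m) z (g • z)
      rw [hi z (g • z), hi m (g • z), hi m z] at e1
      rw [hi m z] at e2
      rw [dist_comm m z] at e1 e2
      have e3 : dist (g • m) z ≤ dist z (g • z) / 2 := by
        rcases le_max_iff.1 e1 with h | h <;> linarith
      have e4 : dist m (g • m) ≤ 0 := by
        rcases le_max_iff.1 e2 with h | h <;> linarith
      have e5 : dist m (g • m) = 0 := le_antisymm e4 dist_nonneg
      refine ⟨m, by linarith, fun p => ?_⟩
      rw [e5]; exact dist_nonneg
    · push Not at hc
      have tri := dist_triangle z (g • z) (g • g • z)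
      rw [hi] at tri
      obtain ⟨y, h1, h2⟩ := T.geodesic z (g • z) (dist z (g • z) - dist z (g • g • z) / 2)
        (by linarith) (by linarith [dist_nonneg (x := z) (y := g • g • z)])
      have e1 := T.fourPoint (g • y) z (g • z) (g • g • z)
      have e2 := T.fourPoint y (g • y) z (g • z)
      rw [hi z (g • z), hi y (g • z), hi y z] at e1
      rw [hi y z] at e2
      rw [dist_comm y z] at e1 e2
      have e3 : dist (g • y) z ≤ dist z (g • z) - dist z y := by
        rcases le_max_iff.1 e1 with h | h <;> linarith
      have e4 : dist y (g • y) ≤ dist z (g • z) - 2 * dist z y := by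
        rcases le_max_iff.1 e2 with h | h <;> linarith
      have e5 := dist_triangle4 z y (g • y) (g • z)
      rw [hi, dist_comm y z] at e5
      have e6 := dist_triangle4 z y (g • g • y) (g • g • z)
      rw [hi, hi, dist_comm y z] at e6
      have e7 : dist y (g • g • y) ≥ 2 * dist y (g • y) := by linarith
      refine ⟨y, by linarith, fun p => ?_⟩
      have f := T.fourPoint p (g • y) y (g • g • y)
      rw [hi, dist_comm (g • y) y] at f
      have t1 := dist_triangle p (g • p) (g • g • y)
      rw [hi] at t1
      have t2 := dist_triangle (g • p) p (g • y)
      rw [hi, dist_comm (g • p) p] at t2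
      rcases le_max_iff.1 f with h | h <;> linarith
  obtain ⟨y, h1, h2⟩ := key
  have hne : Nonempty T.carrier := T.nonempty
  have hl : T.ell g = dist y (g • y) := by
    apply le_antisymm
    · exact ciInf_le ⟨0, by rintro _ ⟨p, rfl⟩; exact dist_nonneg⟩ y
    · exact le_ciInf h2
  refine ⟨y, hl.symm, fun q hq => ?_⟩
  have hq' : dist q (g • q) = T.ell g := hq
  have e5 := dist_triangle4 z q (g • q) (g • z)
  rw [(T.isom g).dist_eq, dist_comm q z] at e5
  linarith

theorem aux_convex {G : Type} [Group G] (T : GTree G) (g : G) (x y w : T.carrier)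
    (hw : dist x w + dist w y ≤ dist x y) (hy : dist y (g • y) ≤ dist x (g • x)) :
    dist w (g • w) ≤ dist x (g • x) := by
  have hi : ∀ a b : T.carrier, dist (g • a) (g • b) = dist a b := fun a b => (T.isom g).dist_eq a b
  have f1 := T.fourPoint w (g • x) x y
  have f2 := T.fourPoint w (g • y) x y
  have f3 := T.fourPoint w (g • w) (g • x) (g • y)
  rw [hi, hi, hi] at f3
  have t1 := dist_triangle x (g • x) (g • y)
  have t2 := dist_triangle y x (g • x)
  rw [hi] at t1
  rw [dist_comm (g • x) y, dist_comm (g • x) x, dist_comm w x] at f1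
  rw [dist_comm (g • y) y, dist_comm (g • y) x, dist_comm w x] at f2
  rw [dist_comm w x] at f3
  rw [dist_comm y x] at t2
  have := dist_nonneg (x := x) (y := w)
  have := dist_nonneg (x := w) (y := y)
  rcases le_max_iff.1 f1 with h | h <;> rcases le_max_iff.1 f2 with h' | h' <;>
    rcases le_max_iff.1 f3 with h'' | h'' <;> linarith

/-- For z ∉ T_S and x = p_{T_S}(z), there is g ∈ S with
d(x,gx) = l_T(S) such that x lies on the arc from z to T_g. -/
theorem stmt_12 {G : Type} [Group G] (T : GTree G) (S : Finset G)
    (z x : T.carrier) (hz : z ∉ T.charSetS S)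
    (hx : IsNearestPt (T.charSetS S) z x) :
    ∃ g ∈ S, dist x (g • x) = T.ellS S ∧
      ∃ y : T.carrier, IsNearestPt (T.charSet g) z y ∧ x ∈ seg z y := by
  have hxS : T.dispS S x = T.ellS S := hx.1
  have hle : ∀ w : T.carrier, T.ellS S ≤ T.dispS S w := by
    intro w
    apply csInf_le
    · refine ⟨0, ?_⟩
      rintro _ ⟨p, rfl⟩
      apply Real.sSup_nonneg
      rintro _ ⟨g, _, rfl⟩
      exact dist_nonneg
    · exact ⟨w, rfl⟩
  have hne : S.Nonempty := by
    by_contra h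
    rw [Finset.not_nonempty_iff_eq_empty] at h
    subst h
    apply hz
    change T.dispS ∅ z = T.ellS ∅
    rw [← hxS]
    simp [GTree.dispS]
  have hmem : ∀ w : T.carrier, (∀ g ∈ S, dist w (g • w) ≤ T.ellS S) → w ∈ T.charSetS S := by
    intro w h
    apply le_antisymm _ (hle w)
    apply csSup_le
    · obtain ⟨g, hg⟩ := hne
      exact ⟨_, g, hg, rfl⟩
    · rintro _ ⟨g, hg, rfl⟩
      exact h g hg
  have hxg : ∀ g ∈ S, dist x (g • x) ≤ T.ellS S := by
    intro g hg
    rw [← hxS]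
    apply le_csSup
    · refine ((S.finite_toSet.image (fun g => dist x (g • x))).subset ?_).bddAbove
      rintro _ ⟨g, hg, rfl⟩
      exact ⟨g, hg, rfl⟩
    · exact ⟨g, hg, rfl⟩
  have hzx : 0 < dist x z := by
    apply dist_pos.2
    rintro rfl
    exact hz hx.1
  by_contra hcon
  push Not at hcon
  have hev : ∀ g ∈ S, ∀ᶠ r in 𝓝[>] (0:ℝ), ∀ w : T.carrier, dist x w = r →
      dist w z = dist x z - r → dist w (g • w) ≤ T.ellS S := by
    intro g hg
    obtain ⟨y, hy⟩ := aux_proj T g z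
    by_cases hD : dist x (g • x) = T.ellS S
    · have hns := hcon g hg hD y hy
      have hlt : dist z y < dist z x + dist x y :=
        lt_of_le_of_ne (dist_triangle z x y) (fun h => hns h.symm)
      rw [dist_comm z x] at hlt
      have hpos : 0 < (dist x z + dist x y - dist z y) / 2 := by linarith
      filter_upwards [Ioo_mem_nhdsGT hpos] with r hr w h1 h2
      rw [← hD]
      apply aux_convex T g x y w
      · have f := T.fourPoint w y x z
        rw [dist_comm w x, dist_comm y x, dist_comm y z] at f
        have := hr.2
        rcases le_max_iff.1 f with h | h <;> linarith
      · have : dist y (g • y) = T.ell g := hy.1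
        rw [this]
        exact ciInf_le ⟨0, by rintro _ ⟨p, rfl⟩; exact dist_nonneg⟩ x
    · have hlt := lt_of_le_of_ne (hxg g hg) hD
      have hpos : 0 < (T.ellS S - dist x (g • x)) / 2 := by linarith
      filter_upwards [Ioo_mem_nhdsGT hpos] with r hr w h1 h2
      have t := dist_triangle4 w x (g • x) (g • w)
      rw [(T.isom g).dist_eq, dist_comm w x] at t
      linarith [hr.2]
  obtain ⟨r, hr, hr0⟩ := (((Finset.eventually_all S).2 hev).and (Ioo_mem_nhdsGT hzx)).exists
  obtain ⟨w, h1, h2⟩ := T.geodesic x z r hr0.1.le hr0.2.le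
  have hw := hmem w (fun g hg => hr g hg w h1 h2)
  have := hx.2 w hw
  rw [dist_comm z x, dist_comm z w] at this
  linarith [hr0.1]

end
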